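/- Let p be a fixed-height binary tree source. Then for every h ∈ ℕ₀, ∑_{t : h(t)=h} P[t] = 1, the sum ranging over the (finitely many) binary trees of height exactly h. -/

import Mathlib

inductive BinTree : Type where
  | leaf : BinTree
  | node : BinTree → BinTree → BinTree
deriving DecidableEq

namespace BinTree

def size : BinTree → ℕ
  | leaf => 0
  | node l r => 1 + size l + size r

def height : BinTree → ℕ
  | leaf => 0
  | node l r => 1 + max (height l) (height r)

def subtreeAt : BinTree → List Bool → BinTree
  | t, [] => t
  | leaf, _ :: _ => leaf
  | node l r, b :: v => subtreeAt (if b then r else l) v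

def countGE (b : ℕ) : BinTree → ℕ
  | leaf => 0
  | node l r => (if b ≤ size (node l r) then 1 else 0) + countGE b l + countGE b r

end BinTree

noncomputable def fsProb (p : ℕ → ℕ → ℝ) : BinTree → ℝ
  | .leaf => 1
  | .node l r => p l.size r.size * fsProb p l * fsProb p r

noncomputable def fhProb (p : ℕ → ℕ → ℝ) : BinTree → ℝ
  | .leaf => 1
  | .node l r => p l.height r.height * fhProb p l * fhProb p r

def IsFixedSizeSource (p : ℕ → ℕ → ℝ) : Prop :=
  (∀ ℓ r, 0 ≤ p ℓ r ∧ p ℓ r ≤ 1) ∧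
  ∀ n : ℕ, ∑ ℓ ∈ Finset.range (n + 1), p ℓ (n - ℓ) = 1

def IsFixedHeightSource (p : ℕ → ℕ → ℝ) : Prop :=
  (∀ i j, 0 ≤ p i j ∧ p i j ≤ 1) ∧
  ∀ h : ℕ,
    ∑ ij ∈ (Finset.range (h + 1) ×ˢ Finset.range (h + 1)).filter
        (fun ij => max ij.1 ij.2 = h), p ij.1 ij.2 = 1

theorem fhProb_aux (p : ℕ → ℕ → ℝ) (hp : IsFixedHeightSource p) (n : ℕ) :
    ∃ S : ℕ → Finset BinTree, ∀ h ≤ n, (∀ t, t ∈ S h ↔ t.height = h) ∧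
      ∑ t ∈ S h, fhProb p t = 1 := by
  classical
  induction n with
  | zero =>
    refine ⟨fun _ => {BinTree.leaf}, fun h hh => ?_⟩
    obtain rfl : h = 0 := by omega
    refine ⟨fun t => ?_, by simp [fhProb]⟩
    cases t <;> simp [BinTree.height]
  | succ n ih =>
    obtain ⟨S, hS⟩ := ih
    let F := (Finset.range (n + 1) ×ˢ Finset.range (n + 1)).filter
        (fun ij : ℕ × ℕ => max ij.1 ij.2 = n)
    let G : Finset (Σ _ : ℕ × ℕ, BinTree × BinTree) := F.sigma (fun ij => S ij.1 ×ˢ S ij.2)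
    let f : (Σ _ : ℕ × ℕ, BinTree × BinTree) → BinTree := fun x => BinTree.node x.2.1 x.2.2
    have hF : ∀ i j, (i, j) ∈ F ↔ (i ≤ n ∧ j ≤ n ∧ max i j = n) := by
      intro i j
      simp only [F, Finset.mem_filter, Finset.mem_product, Finset.mem_range]
      omega
    refine ⟨fun h => if h = n + 1 then G.image f else S h, fun h hh => ?_⟩
    by_cases hn : h = n + 1
    · subst hn
      simp only [if_true]
      constructor
      · intro t
        simp only [Finset.mem_image, G, Finset.mem_sigma, Finset.mem_product, f]
        constructor
        · rintro ⟨⟨⟨i, j⟩, l, r⟩, ⟨hij, hl, hr⟩, rfl⟩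
          obtain ⟨hi, hj, hm⟩ := (hF i j).1 hij
          have h1 := ((hS i hi).1 l).1 hl
          have h2 := ((hS j hj).1 r).1 hr
          simp only [BinTree.height, h1, h2]
          omega
        · intro ht
          cases t with
          | leaf => simp [BinTree.height] at ht
          | node l r =>
            simp only [BinTree.height] at ht
            have hl : l.height ≤ n := by omega
            have hr : r.height ≤ n := by omega
            exact ⟨⟨(l.height, r.height), l, r⟩,
              ⟨(hF _ _).2 ⟨hl, hr, by omega⟩, ((hS _ hl).1 l).2 rfl, ((hS _ hr).1 r).2 rfl⟩, rfl⟩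
      · rw [Finset.sum_image]
        · rw [Finset.sum_sigma, ← hp.2 n]
          refine Finset.sum_congr rfl ?_
          rintro ⟨i, j⟩ hij
          obtain ⟨hi, hj, hm⟩ := (hF i j).1 hij
          have key : ∀ x ∈ S i ×ˢ S j, fhProb p (f ⟨(i, j), x⟩)
              = p i j * (fhProb p x.1 * fhProb p x.2) := by
            rintro ⟨l, r⟩ hx
            rw [Finset.mem_product] at hx
            have h1 := ((hS i hi).1 l).1 hx.1
            have h2 := ((hS j hj).1 r).1 hx.2
            simp only [f, fhProb, h1, h2, mul_assoc]
          rw [Finset.sum_congr rfl key, ← Finset.mul_sum, Finset.sum_product,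
            ← Finset.sum_mul_sum, (hS i hi).2, (hS j hj).2]
          simp
        · rintro ⟨⟨i, j⟩, l, r⟩ hx ⟨⟨i', j'⟩, l', r'⟩ hy hxy
          simp only [f, BinTree.node.injEq] at hxy
          obtain ⟨rfl, rfl⟩ := hxy
          simp only [G, Finset.coe_sigma, Set.mem_sigma_iff, Finset.mem_coe,
            Finset.mem_product] at hx hy
          obtain ⟨hi, hj, -⟩ := (hF i j).1 hx.1
          obtain ⟨hi', hj', -⟩ := (hF i' j').1 hy.1
          have h1 := ((hS i hi).1 l).1 hx.2.1
          have h2 := ((hS j hj).1 r).1 hx.2.2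
          have h3 := ((hS i' hi').1 l).1 hy.2.1
          have h4 := ((hS j' hj').1 r).1 hy.2.2
          subst h1 h2 h3 h4
          rfl
    · simp only [if_neg hn]
      exact hS h (by omega)

/-- a fixed-height source induces a probability distribution on
the (finite) set of binary trees of height exactly `h`. -/
theorem statement7 (p : ℕ → ℕ → ℝ) (hp : IsFixedHeightSource p) (h : ℕ) :
    ∑' t : {t : BinTree // t.height = h}, fhProb p t.1 = 1 := by
  obtain ⟨S, hS⟩ := fhProb_aux p hp h
  obtain ⟨h1, h2⟩ := hS h le_rfl
  have hset : {t : BinTree | t.height = h} = (S h : Set BinTree) := by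
    ext t
    simp [h1]
  change ∑' t : ({t : BinTree | t.height = h} : Set BinTree), fhProb p t.1 = 1
  rw [hset, ← h2]
  exact Finset.tsum_subtype (S h) (fhProb p)
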